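/- arXiv:1602.08059 — 2 statements merged into one kernel-verified Lean document; each statement's English description precedes it below -/
import Mathlib

section
/- Let a > 0 and let ψ : ℝ → ℝ be a smooth function whose closed support is exactly the interval [0, a]. Then for every c > 0, the four functions x ↦ ψ(x), x ↦ ψ'(x), x ↦ ψ(x−c), x ↦ ψ'(x−c) are linearly independent over ℝ. -/
open Real MeasureTheory

noncomputable section

/-- A solution of `y' = k y` on `(-∞, c)` that vanishes somewhere there vanishes identically. -/
theorem eq_zero_of_deriv_eq_mul {f : ℝ → ℝ} (hf : Differentiable ℝ f) {k c x₀ : ℝ}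
    (hode : ∀ x < c, deriv f x = k * f x) (hx₀ : x₀ < c) (h₀ : f x₀ = 0) :
    ∀ x < c, f x = 0 := by
  intro x hx
  have hder (y : ℝ) : HasDerivAt (fun y => Real.exp (-k * y) * f y)
      (Real.exp (-k * y) * (-k * 1) * f y + Real.exp (-k * y) * deriv f y) y :=
    (((hasDerivAt_id y).const_mul (-k)).exp).mul (hf y).hasDerivAt
  have hconst := isOpen_Iio.is_const_of_deriv_eq_zero (𝕜 := ℝ) (s := Set.Iio c)
    isPreconnected_Iio (fun y _ => (hder y).differentiableAt.differentiableWithinAt)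
    (fun y hy => by
      rw [(hder y).deriv, hode y hy, Pi.zero_apply]
      ring)
    hx hx₀
  simpa [h₀, Real.exp_ne_zero] using hconst

/-- A first order relation with constant coefficients satisfied by `f` past the left end `0` of
its support is trivial. -/
theorem coeff_eq_zero_of_mul_add_mul_deriv {f : ℝ → ℝ} (hf : Differentiable ℝ f)
    (hneg : ∀ x < 0, f x = 0) (hmem : (0 : ℝ) ∈ tsupport f) {α β c : ℝ} (hc : 0 < c)
    (hrel : ∀ x < c, α * f x + β * deriv f x = 0) : α = 0 ∧ β = 0 := by
  have key : ¬ ∀ x < c, f x = 0 := fun h =>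
    notMem_tsupport_iff_eventuallyEq.2 (Filter.eventually_of_mem (Iio_mem_nhds hc) h) hmem
  have hβ : β = 0 := by
    by_contra hβ
    refine key (eq_zero_of_deriv_eq_mul hf (k := -α / β) (fun x hx => ?_)
      (show (-1 : ℝ) < c by linarith) (hneg _ (by norm_num)))
    field_simp
    linarith [hrel x hx]
  refine ⟨?_, hβ⟩
  by_contra hα
  exact key fun x hx => by simpa [hβ, hα] using hrel x hx

/-- the linear independence argument (6.22) of Section 6.  If `ψ` is
smooth with closed support exactly `[0, a]`, then for every `c > 0` the functions
`ψ, ψ', ψ(·-c), ψ'(·-c)` are linearly independent. -/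
theorem stmt18 (a : ℝ) (ha : 0 < a) (ψ : ℝ → ℝ)
    (hψ : ContDiff ℝ (⊤ : ℕ∞) ψ)
    (hsupp : tsupport ψ = Set.Icc 0 a)
    (c : ℝ) (hc : 0 < c) :
    LinearIndependent ℝ
      ![ψ, deriv ψ, fun x => ψ (x - c), fun x => deriv ψ (x - c)] := by
  have hd : Differentiable ℝ ψ := hψ.differentiable (by simp)
  have hout : ∀ x < 0, x ∉ tsupport ψ := fun x hx h => by
    rw [hsupp] at h
    exact absurd h.1 (not_le.2 hx)
  have hneg : ∀ x < 0, ψ x = 0 := fun x hx => image_eq_zero_of_notMem_tsupport (hout x hx)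
  have hneg' : ∀ x < 0, deriv ψ x = 0 := fun x hx => by
    by_contra h
    exact hout x hx (support_deriv_subset h)
  have hmem : (0 : ℝ) ∈ tsupport ψ := by
    rw [hsupp]
    exact ⟨le_rfl, ha.le⟩
  rw [Fintype.linearIndependent_iff]
  intro g hg
  have hrel (x : ℝ) : g 0 * ψ x + g 1 * deriv ψ x + g 2 * ψ (x - c)
      + g 3 * deriv ψ (x - c) = 0 := by
    simpa [Fin.sum_univ_four] using congrFun hg x
  obtain ⟨h0, h1⟩ := coeff_eq_zero_of_mul_add_mul_deriv hd hneg hmem hc fun x hx => by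
    simpa [hneg (x - c) (by linarith), hneg' (x - c) (by linarith)] using hrel x
  obtain ⟨h2, h3⟩ := coeff_eq_zero_of_mul_add_mul_deriv hd hneg hmem hc fun x _ => by
    simpa [h0, h1] using hrel (x + c)
  intro i
  fin_cases i <;> assumption
end
end

section
/- Let p > 5 be a real number. Suppose M, E_tt, E_rr, E_ωω : Γ₁ → ℝ are smooth even functions and E_tr : Γ₁ → ℝ is a smooth odd function, with M homogeneous of order −4/(p−1) and E_tt, E_tr, E_rr, E_ωω homogeneous of order −2(p+1)/(p−1), with E_rr − E_ωω vanishing to second order at r = 0, such that on Γ₁ with r ≠ 0: ∂_t[(1/2)(−∂_tt M + ∂_rr M + (2/r)∂_r M) − (−E_tt + E_rr + 2E_ωω)] = (p+1)[−∂_t E_tt + ∂_r E_tr + (2/r)E_tr − (1/2)∂_t(−E_tt + E_rr + 2E_ωω)] and ∂_r[(1/2)(−∂_tt M + ∂_rr M + (2/r)∂_r M) − (−E_tt + E_rr + 2E_ωω)] = (p+1)[−∂_t E_tr + ∂_r E_rr + (2/r)(E_rr − E_ωω) − (1/2)∂_r(−E_tt + E_rr + 2E_ωω)], the nonstrict inequalities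 (1/2)(−∂_tt M + ∂_rr M + (2/r)∂_r M) − (−E_tt + E_rr + 2E_ωω) ≥ 0 and E_ωω ≥ 0 hold on Γ₁, the 3×3 matrix [[M, (1/2)∂_t M, (1/2)∂_r M], [(1/2)∂_t M, E_tt, E_tr], [(1/2)∂_r M, E_tr, E_rr]] is strictly positive definite for r ≠ 0, and the 2×2 matrix [[M, (1/2)∂_t M], [(1/2)∂_t M, E_tt]] is strictly positive definite at r = 0. Then there exist smooth even functions M^ε, E^ε_tt, E^ε_rr, E^ε_ωω : Γ₁ → ℝ and a smooth odd function E^ε_tr : Γ₁ → ℝ with the same homogeneity orders and the same vanishing condition on E^ε_rr − E^ε_ωω, satisfying the same two differential equations, the strict inequalities (1/2)(−∂_tt M^ε + ∂_rr M^ε + (2/r)∂_r M^ε) − (−E^ε_tt + E^ε_rr + 2E^ε_ωω) > 0 and E^ε_ωω > 0 on Γ₁, with the corresponding 3×3 matrix strictly positive definite for r ≠ 0 and the corresponding 2×2 matrix strictly positive definite at r = 0. -/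
open Real MeasureTheory

noncomputable section

/-- The `1+1`-dimensional light cone `Γ₁ = {(t,r) : t > 0, -t ≤ r ≤ t}`. -/
def Cone1 : Set (ℝ × ℝ) := {q | 0 < q.1 ∧ |q.2| ≤ q.1}

/-- The partial derivative `∂_t` on `ℝ × ℝ`. -/
def pdt (f : ℝ × ℝ → ℝ) : ℝ × ℝ → ℝ := fun q => fderiv ℝ f q (1, 0)

/-- The partial derivative `∂_r` on `ℝ × ℝ`. -/
def pdr (f : ℝ × ℝ → ℝ) : ℝ × ℝ → ℝ := fun q => fderiv ℝ f q (0, 1)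

/-- `f` is even in `r` on `Γ₁`. -/
def IsEvenR (f : ℝ × ℝ → ℝ) : Prop := ∀ q ∈ Cone1, f (q.1, -q.2) = f q

/-- `f` is odd in `r` on `Γ₁`. -/
def IsOddR (f : ℝ × ℝ → ℝ) : Prop := ∀ q ∈ Cone1, f (q.1, -q.2) = -f q

/-- `f` is homogeneous of order `α` on `Γ₁`. -/
def HomogOrder (α : ℝ) (f : ℝ × ℝ → ℝ) : Prop :=
  ∀ l : ℝ, 0 < l → ∀ q ∈ Cone1, f (l • q) = l ^ α * f q

/-- `g` vanishes to `k`-th order at `r = 0`: `g, ∂_r g, …, ∂_r^{k-1} g` all vanish at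
`(t, 0)` for every `t > 0`. -/
def VanishOrder (k : ℕ) (g : ℝ × ℝ → ℝ) : Prop :=
  ∀ t : ℝ, 0 < t → ∀ j < k, (pdr^[j] g) (t, 0) = 0

/-- `f` is smooth on `Γ₁`: it is smooth on some open neighbourhood of `Γ₁`. -/
def SmoothOnCone1 (f : ℝ × ℝ → ℝ) : Prop :=
  ∃ Ω : Set (ℝ × ℝ), IsOpen Ω ∧ Cone1 ⊆ Ω ∧ ContDiffOn ℝ (⊤ : ℕ∞) f Ω

/-- The defocusing quantity
`(1/2)(-∂_tt M + ∂_rr M + (2/r)∂_r M) - (-E_tt + E_rr + 2 E_ωω)` (for `d = 3`). -/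
def defocusQty (M Ett Err Eww : ℝ × ℝ → ℝ) : ℝ × ℝ → ℝ :=
  fun q => (1 / 2) * (-(pdt (pdt M) q) + pdr (pdr M) q + (2 / q.2) * pdr M q)
    - (-(Ett q) + Err q + 2 * Eww q)

/-- The `3×3` matrix. -/
def mat3 (M Ett Err Etr : ℝ × ℝ → ℝ) (q : ℝ × ℝ) : Matrix (Fin 3) (Fin 3) ℝ :=
  !![M q, (1 / 2) * pdt M q, (1 / 2) * pdr M q;
     (1 / 2) * pdt M q, Ett q, Etr q;
     (1 / 2) * pdr M q, Etr q, Err q]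

/-- The `2×2` matrix. -/
def mat2 (M Ett : ℝ × ℝ → ℝ) (q : ℝ × ℝ) : Matrix (Fin 2) (Fin 2) ℝ :=
  !![M q, (1 / 2) * pdt M q;
     (1 / 2) * pdt M q, Ett q]

/-- The structural conditions shared by the fields in Theorem 5.1: smoothness, parity,
homogeneity, the vanishing of `E_rr - E_ωω` to second order, the two divergence
equations, and the positive definiteness of the `3×3` matrix (for `r ≠ 0`) and the
`2×2` matrix (at `r = 0`). -/
def GoodFields (p : ℝ) (M Ett Err Eww Etr : ℝ × ℝ → ℝ) : Prop :=
  SmoothOnCone1 M ∧ SmoothOnCone1 Ett ∧ SmoothOnCone1 Err ∧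
  SmoothOnCone1 Eww ∧ SmoothOnCone1 Etr ∧
  IsEvenR M ∧ IsEvenR Ett ∧ IsEvenR Err ∧ IsEvenR Eww ∧ IsOddR Etr ∧
  HomogOrder (-(4 / (p - 1))) M ∧
  HomogOrder (-(2 * (p + 1) / (p - 1))) Ett ∧
  HomogOrder (-(2 * (p + 1) / (p - 1))) Etr ∧
  HomogOrder (-(2 * (p + 1) / (p - 1))) Err ∧
  HomogOrder (-(2 * (p + 1) / (p - 1))) Eww ∧
  VanishOrder 2 (fun q => Err q - Eww q) ∧
  (∀ q ∈ Cone1, q.2 ≠ 0 →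
    pdt (defocusQty M Ett Err Eww) q
      = (p + 1) * (-(pdt Ett q) + pdr Etr q + (2 / q.2) * Etr q
          - (1 / 2) * pdt (fun z => -(Ett z) + Err z + 2 * Eww z) q)) ∧
  (∀ q ∈ Cone1, q.2 ≠ 0 →
    pdr (defocusQty M Ett Err Eww) q
      = (p + 1) * (-(pdt Etr q) + pdr Err q + (2 / q.2) * (Err q - Eww q)
          - (1 / 2) * pdr (fun z => -(Ett z) + Err z + 2 * Eww z) q)) ∧
  (∀ q ∈ Cone1, q.2 ≠ 0 → (mat3 M Ett Err Etr q).PosDef) ∧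
  (∀ q ∈ Cone1, q.2 = 0 → (mat2 M Ett q).PosDef)

lemma convex_cone1 : Convex ℝ Cone1 := by
  rintro ⟨t, r⟩ ⟨ht, hr⟩ ⟨t', r'⟩ ⟨ht', hr'⟩ a b ha hb hab
  simp only [Cone1, Set.mem_ofPred_eq, Prod.fst_add, Prod.snd_add, Prod.smul_fst, Prod.smul_snd,
    smul_eq_mul] at *
  rw [abs_le] at *
  refine ⟨?_, ?_, ?_⟩
  · rcases ha.eq_or_lt with rfl | ha
    · obtain rfl : b = 1 := by linarith
      simpa using ht'
    · have := mul_pos ha ht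
      have := mul_nonneg hb ht'.le
      linarith
  · have := mul_le_mul_of_nonneg_left hr.1 ha
    have := mul_le_mul_of_nonneg_left hr'.1 hb
    linarith
  · have := mul_le_mul_of_nonneg_left hr.2 ha
    have := mul_le_mul_of_nonneg_left hr'.2 hb
    linarith

lemma uniqueDiffOn_cone1 : UniqueDiffOn ℝ Cone1 := by
  refine uniqueDiffOn_convex convex_cone1 ⟨(1, 0), ?_⟩
  have hopen : IsOpen {q : ℝ × ℝ | |q.2| < q.1} := isOpen_lt (by fun_prop) (by fun_prop)
  refine interior_maximal (fun q hq => ?_) hopen (by simp : |(0 : ℝ)| < 1)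
  exact ⟨(abs_nonneg _).trans_lt hq, le_of_lt hq⟩

lemma SmoothOnCone1.contDiffAt {f : ℝ × ℝ → ℝ} (hf : SmoothOnCone1 f) {q : ℝ × ℝ}
    (hq : q ∈ Cone1) (n : ℕ) : ContDiffAt ℝ n f q := by
  obtain ⟨Ω, hΩ, hsub, h⟩ := hf
  exact (h.contDiffAt (hΩ.mem_nhds (hsub hq))).of_le (by exact_mod_cast le_top)

/-- A linear symmetry of `f` on the cone passes to the full derivative of `f`, also at
boundary points of the cone. -/
lemma fderiv_apply_of_cone1_symm {f : ℝ × ℝ → ℝ} (hf : SmoothOnCone1 f)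
    (L : ℝ × ℝ →L[ℝ] ℝ × ℝ) (hL : ∀ q ∈ Cone1, L q ∈ Cone1) (c : ℝ)
    (h : ∀ q ∈ Cone1, f (L q) = c * f q) {q : ℝ × ℝ} (hq : q ∈ Cone1) (v : ℝ × ℝ) :
    fderiv ℝ f (L q) (L v) = c * fderiv ℝ f q v := by
  have hd {z : ℝ × ℝ} (hz : z ∈ Cone1) : DifferentiableAt ℝ f z :=
    (hf.contDiffAt hz 1).differentiableAt (by simp)
  have h1 : HasFDerivWithinAt (fun z => f (L z)) ((fderiv ℝ f (L q)).comp L) Cone1 q :=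
    ((hd (hL q hq)).hasFDerivAt.comp q L.hasFDerivAt).hasFDerivWithinAt
  have h2 : HasFDerivWithinAt (fun z => f (L z)) (c • fderiv ℝ f q) Cone1 q :=
    ((hd hq).hasFDerivAt.const_mul c).hasFDerivWithinAt.congr h (h q hq)
  have := (uniqueDiffOn_cone1 q hq).eq h1 h2
  simpa using congrArg (fun T => T v) this

lemma smul_mem_cone1 {l : ℝ} (hl : 0 < l) {q : ℝ × ℝ} (hq : q ∈ Cone1) : l • q ∈ Cone1 := by
  refine ⟨mul_pos hl hq.1, ?_⟩
  simpa [abs_mul, abs_of_pos hl] using mul_le_mul_of_nonneg_left hq.2 hl.le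

lemma HomogOrder.fderiv_smul {f : ℝ × ℝ → ℝ} {a : ℝ} (hf : SmoothOnCone1 f)
    (h : HomogOrder a f) {l : ℝ} (hl : 0 < l) {q : ℝ × ℝ} (hq : q ∈ Cone1) (v : ℝ × ℝ) :
    l * fderiv ℝ f (l • q) v = l ^ a * fderiv ℝ f q v := by
  simpa using fderiv_apply_of_cone1_symm hf (l • ContinuousLinearMap.id ℝ (ℝ × ℝ))
    (fun _ hz => smul_mem_cone1 hl hz) (l ^ a) (h l hl) hq v

lemma IsEvenR.pdr_eq_zero {f : ℝ × ℝ → ℝ} (hf : SmoothOnCone1 f) (h : IsEvenR f) {t : ℝ}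
    (ht : 0 < t) : pdr f (t, 0) = 0 := by
  have := fderiv_apply_of_cone1_symm hf
    ((ContinuousLinearMap.fst ℝ ℝ ℝ).prod (-ContinuousLinearMap.snd ℝ ℝ ℝ))
    (fun z hz => ⟨hz.1, by simpa using hz.2⟩) 1 (fun z hz => by simpa using h z hz)
    (q := (t, 0)) ⟨ht, by simpa using ht.le⟩ (0, 1)
  have h2 : ((0 : ℝ), (-1 : ℝ)) = -(0, 1) := by simp
  simp only [ContinuousLinearMap.prod_apply, ContinuousLinearMap.coe_fst',
    neg_apply, ContinuousLinearMap.coe_snd', neg_zero, h2, map_neg, one_mul] at this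
  unfold pdr
  linarith

lemma contDiffAt_pdt {f : ℝ × ℝ → ℝ} {q : ℝ × ℝ} {n : ℕ} (hf : ContDiffAt ℝ (n + 1) f q) :
    ContDiffAt ℝ n (pdt f) q :=
  hf.fderiv_right_succ.clm_apply contDiffAt_const

lemma contDiffAt_pdr {f : ℝ × ℝ → ℝ} {q : ℝ × ℝ} {n : ℕ} (hf : ContDiffAt ℝ (n + 1) f q) :
    ContDiffAt ℝ n (pdr f) q :=
  hf.fderiv_right_succ.clm_apply contDiffAt_const

lemma fderiv_add_mul_rpow {f : ℝ × ℝ → ℝ} {q : ℝ × ℝ} (hf : DifferentiableAt ℝ f q)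
    (hq : 0 < q.1) (c a : ℝ) (v : ℝ × ℝ) :
    fderiv ℝ (fun z => f z + c * z.1 ^ a) q v = fderiv ℝ f q v + c * (a * q.1 ^ (a - 1)) * v.1 := by
  have h1 : HasFDerivAt (fun z : ℝ × ℝ => z.1 ^ a) _ q :=
    (hasFDerivAt_fst (𝕜 := ℝ) (p := q)).rpow_const (p := a) (Or.inl hq.ne')
  rw [(hf.hasFDerivAt.fun_add (h1.const_mul c)).fderiv]
  simp
  ring

lemma pdt_add_mul_rpow {f : ℝ × ℝ → ℝ} {q : ℝ × ℝ} (hf : DifferentiableAt ℝ f q)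
    (hq : 0 < q.1) (c a : ℝ) :
    pdt (fun z => f z + c * z.1 ^ a) q = pdt f q + c * a * q.1 ^ (a - 1) := by
  simp only [pdt, fderiv_add_mul_rpow hf hq]
  ring

lemma pdr_add_mul_rpow {f : ℝ × ℝ → ℝ} {q : ℝ × ℝ} (hf : DifferentiableAt ℝ f q)
    (hq : 0 < q.1) (c a : ℝ) :
    pdr (fun z => f z + c * z.1 ^ a) q = pdr f q := by
  simp [pdr, fderiv_add_mul_rpow hf hq]

lemma pdt_congr {f g : ℝ × ℝ → ℝ} {q : ℝ × ℝ} (h : f =ᶠ[nhds q] g) : pdt f q = pdt g q := by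
  simp only [pdt, h.fderiv_eq]

lemma pdr_congr {f g : ℝ × ℝ → ℝ} {q : ℝ × ℝ} (h : f =ᶠ[nhds q] g) : pdr f q = pdr g q := by
  simp only [pdr, h.fderiv_eq]

lemma eventually_fst_pos {q : ℝ × ℝ} (hq : 0 < q.1) : ∀ᶠ z in nhds q, 0 < z.1 :=
  (isOpen_lt continuous_const continuous_fst).mem_nhds hq

lemma eventually_differentiableAt {f : ℝ × ℝ → ℝ} {q : ℝ × ℝ} {n : ℕ} (hn : n ≠ 0)
    (hf : ContDiffAt ℝ n f q) : ∀ᶠ z in nhds q, DifferentiableAt ℝ f z :=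
  (hf.eventually (by simp)).mono fun _ h => h.differentiableAt (by exact_mod_cast hn)

lemma pdt_pdt_add_mul_rpow {f : ℝ × ℝ → ℝ} {q : ℝ × ℝ} (hf : ContDiffAt ℝ 2 f q)
    (hq : 0 < q.1) (c a : ℝ) :
    pdt (pdt fun z => f z + c * z.1 ^ a) q
      = pdt (pdt f) q + c * a * (a - 1) * q.1 ^ (a - 1 - 1) := by
  have hev : (pdt fun z => f z + c * z.1 ^ a)
      =ᶠ[nhds q] fun z => pdt f z + c * a * z.1 ^ (a - 1) := by
    filter_upwards [eventually_differentiableAt two_ne_zero hf, eventually_fst_pos hq]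
      with z hz hz' using pdt_add_mul_rpow hz hz' c a
  rw [pdt_congr hev, pdt_add_mul_rpow _ hq]
  exact (contDiffAt_pdt (n := 1) (by exact_mod_cast hf)).differentiableAt (by simp)

lemma pdr_pdr_add_mul_rpow {f : ℝ × ℝ → ℝ} {q : ℝ × ℝ} (hf : ContDiffAt ℝ 2 f q)
    (hq : 0 < q.1) (c a : ℝ) :
    pdr (pdr fun z => f z + c * z.1 ^ a) q = pdr (pdr f) q := by
  refine pdr_congr ?_
  filter_upwards [eventually_differentiableAt two_ne_zero hf, eventually_fst_pos hq]
    with z hz hz' using pdr_add_mul_rpow hz hz' c a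

lemma defocusQty_add_mul_rpow {M : ℝ × ℝ → ℝ} (Ett Err Eww : ℝ × ℝ → ℝ) {q : ℝ × ℝ}
    (hM : ContDiffAt ℝ 2 M q) (hq : 0 < q.1) (c a c₁ c₂ c₃ : ℝ) :
    defocusQty (fun z => M z + c * z.1 ^ a) (fun z => Ett z + c₁ * z.1 ^ (a - 2))
        (fun z => Err z + c₂ * z.1 ^ (a - 2)) (fun z => Eww z + c₃ * z.1 ^ (a - 2)) q
      = defocusQty M Ett Err Eww q
        + (-(c * a * (a - 1)) / 2 + c₁ - c₂ - 2 * c₃) * q.1 ^ (a - 2) := by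
  have ha : a - 1 - 1 = a - 2 := by ring
  simp only [defocusQty, pdt_pdt_add_mul_rpow hM hq, pdr_pdr_add_mul_rpow hM hq,
    pdr_add_mul_rpow (hM.differentiableAt two_ne_zero) hq, ha]
  ring

lemma differentiableAt_defocusQty {M Ett Err Eww : ℝ × ℝ → ℝ} {q : ℝ × ℝ}
    (hM : ContDiffAt ℝ 3 M q) (htt : DifferentiableAt ℝ Ett q) (hrr : DifferentiableAt ℝ Err q)
    (hww : DifferentiableAt ℝ Eww q) (hq : q.2 ≠ 0) :
    DifferentiableAt ℝ (defocusQty M Ett Err Eww) q := by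
  have h1 : ContDiffAt ℝ 2 (pdr M) q := contDiffAt_pdr (n := 2) (by exact_mod_cast hM)
  have h2 : ContDiffAt ℝ 2 (pdt M) q := contDiffAt_pdt (n := 2) (by exact_mod_cast hM)
  have h3 : DifferentiableAt ℝ (pdr (pdr M)) q :=
    (contDiffAt_pdr (n := 1) (by exact_mod_cast h1)).differentiableAt (by simp)
  have h4 : DifferentiableAt ℝ (pdt (pdt M)) q :=
    (contDiffAt_pdt (n := 1) (by exact_mod_cast h2)).differentiableAt (by simp)
  have h5 : DifferentiableAt ℝ (pdr M) q := h1.differentiableAt (by simp)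
  have h6 : DifferentiableAt ℝ (fun z : ℝ × ℝ => 2 / z.2) q := by fun_prop (disch := exact hq)
  unfold defocusQty
  fun_prop

lemma SmoothOnCone1.add_mul_rpow {f : ℝ × ℝ → ℝ} (hf : SmoothOnCone1 f) (c a : ℝ) :
    SmoothOnCone1 fun z => f z + c * z.1 ^ a := by
  obtain ⟨Ω, hΩ, hsub, h⟩ := hf
  refine ⟨Ω ∩ {z | 0 < z.1}, hΩ.inter (isOpen_lt continuous_const continuous_fst),
    fun q hq => ⟨hsub hq, hq.1⟩, (h.mono Set.inter_subset_left).add ?_⟩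
  exact contDiffOn_const.mul (contDiffOn_fst.rpow_const_of_ne fun z hz => (ne_of_gt hz.2))

lemma IsEvenR.add_mul_rpow {f : ℝ × ℝ → ℝ} (hf : IsEvenR f) (c a : ℝ) :
    IsEvenR fun z => f z + c * z.1 ^ a := fun q hq => by
  simp [hf q hq]

lemma HomogOrder.add_mul_rpow {f : ℝ × ℝ → ℝ} {a : ℝ} (hf : HomogOrder a f) (c : ℝ) :
    HomogOrder a fun z => f z + c * z.1 ^ a := fun l hl q hq => by
  simp only [hf l hl q hq, Prod.smul_fst, smul_eq_mul, Real.mul_rpow hl.le hq.1.le]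
  ring

/-- If `f` is nonnegative on a compact set, and positive where `g` is nonpositive, then
`f + ε g` is positive for some `ε > 0`. -/
lemma IsCompact.exists_pos_forall_add_mul_pos {X : Type*} [TopologicalSpace X] {S : Set X}
    (hS : IsCompact S) {f g : X → ℝ} (hf : ContinuousOn f S) (hg : Continuous g)
    (h0 : ∀ x ∈ S, 0 ≤ f x) (h : ∀ x ∈ S, g x ≤ 0 → 0 < f x) :
    ∃ ε > 0, ∀ x ∈ S, 0 < f x + ε * g x := by
  have hS' : IsCompact (S ∩ {x | g x ≤ 0}) := hS.inter_right (isClosed_le hg continuous_const)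
  obtain ⟨c, hc, hcf⟩ : ∃ c > 0, ∀ x ∈ S ∩ {x | g x ≤ 0}, c ≤ f x := by
    rcases (S ∩ {x | g x ≤ 0}).eq_empty_or_nonempty with he | hne
    · exact ⟨1, one_pos, by simp [he]⟩
    · obtain ⟨x, hx, hmin⟩ := hS'.exists_isMinOn hne (hf.mono Set.inter_subset_left)
      exact ⟨f x, h x hx.1 hx.2, fun y hy => hmin hy⟩
  obtain ⟨C, hC⟩ := hS'.exists_bound_of_continuousOn hg.continuousOn
  have hC' : 0 < |C| + 1 := by positivity
  refine ⟨c / (|C| + 1), by positivity, fun x hx => ?_⟩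
  rcases lt_or_ge 0 (g x) with hgx | hgx
  · have := h0 x hx
    positivity
  · have h1 := hcf x ⟨hx, hgx⟩
    have h2 : -g x < |C| + 1 := by
      have := hC x ⟨hx, hgx⟩
      rw [Real.norm_eq_abs] at this
      linarith [neg_le_abs (g x), le_abs_self C]
    have h3 : c / (|C| + 1) * -g x < c / (|C| + 1) * (|C| + 1) :=
      mul_lt_mul_of_pos_left h2 (by positivity)
    rw [div_mul_cancel₀ _ hC'.ne'] at h3
    linarith

/-- The quadratic form of the matrix `mat3`. -/
def quadForm3 (M Ett Err Etr : ℝ × ℝ → ℝ) (q : ℝ × ℝ) (x y z : ℝ) : ℝ :=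
  M q * x ^ 2 + pdt M q * x * y + pdr M q * x * z + Ett q * y ^ 2 + 2 * Etr q * y * z
    + Err q * z ^ 2

lemma posDef_mat3_iff {M Ett Err Etr : ℝ × ℝ → ℝ} {q : ℝ × ℝ} :
    (mat3 M Ett Err Etr q).PosDef ↔
      ∀ x y z : ℝ, ¬(x = 0 ∧ y = 0 ∧ z = 0) → 0 < quadForm3 M Ett Err Etr q x y z := by
  have key (x y z : ℝ) : star ![x, y, z] ⬝ᵥ (mat3 M Ett Err Etr q).mulVec ![x, y, z]
      = quadForm3 M Ett Err Etr q x y z := by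
    simp [mat3, quadForm3, Matrix.mulVec, dotProduct, Fin.sum_univ_three]
    ring
  rw [Matrix.posDef_iff_dotProduct_mulVec]
  constructor
  · rintro ⟨-, h⟩ x y z hne
    rw [← key]
    refine h fun h0 => hne ?_
    simpa using h0
  · refine fun h => ⟨?_, fun v hv => ?_⟩
    · ext i j
      fin_cases i <;> fin_cases j <;> simp [mat3]
    · have hv' : v = ![v 0, v 1, v 2] := by ext i; fin_cases i <;> rfl
      rw [hv', key]
      refine h _ _ _ fun ⟨h0, h1, h2⟩ => hv ?_
      rw [hv', h0, h1, h2]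
      simp

lemma posDef_mat2_iff {M Ett : ℝ × ℝ → ℝ} {q : ℝ × ℝ} :
    (mat2 M Ett q).PosDef ↔
      ∀ x y : ℝ, ¬(x = 0 ∧ y = 0) → 0 < M q * x ^ 2 + pdt M q * x * y + Ett q * y ^ 2 := by
  have key (x y : ℝ) : star ![x, y] ⬝ᵥ (mat2 M Ett q).mulVec ![x, y]
      = M q * x ^ 2 + pdt M q * x * y + Ett q * y ^ 2 := by
    simp [mat2, Matrix.mulVec, dotProduct, Fin.sum_univ_two]
    ring
  rw [Matrix.posDef_iff_dotProduct_mulVec]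
  constructor
  · rintro ⟨-, h⟩ x y hne
    rw [← key]
    refine h fun h0 => hne ?_
    simpa using h0
  · refine fun h => ⟨?_, fun v hv => ?_⟩
    · ext i j
      fin_cases i <;> fin_cases j <;> simp [mat2]
    · have hv' : v = ![v 0, v 1] := by ext i; fin_cases i <;> rfl
      rw [hv', key]
      refine h _ _ fun ⟨h0, h1⟩ => hv ?_
      rw [hv', h0, h1]
      simp

lemma quadForm3_smul {M Ett Err Etr : ℝ × ℝ → ℝ} {a : ℝ} (hM : SmoothOnCone1 M)
    (hMa : HomogOrder a M) (htt : HomogOrder (a - 2) Ett) (hrr : HomogOrder (a - 2) Err)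
    (htr : HomogOrder (a - 2) Etr) {l : ℝ} (hl : 0 < l) {q : ℝ × ℝ} (hq : q ∈ Cone1)
    (x y z : ℝ) :
    quadForm3 M Ett Err Etr (l • q) x (l * y) (l * z)
      = l ^ a * quadForm3 M Ett Err Etr q x y z := by
  have h1 : l * pdt M (l • q) = l ^ a * pdt M q := hMa.fderiv_smul hM hl hq _
  have h2 : l * pdr M (l • q) = l ^ a * pdr M q := hMa.fderiv_smul hM hl hq _
  have h3 : l ^ 2 * l ^ (a - 2) = l ^ a := by
    rw [← Real.rpow_natCast, ← Real.rpow_add hl]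
    congr 1
    push_cast
    ring
  simp only [quadForm3, hMa l hl q hq, htt l hl q hq, hrr l hl q hq, htr l hl q hq]
  linear_combination x * y * h1 + x * z * h2
    + (Ett q * y ^ 2 + 2 * Etr q * y * z + Err q * z ^ 2) * h3

/-- On the cone the form `quadForm3` stays positive definite, uniformly in `q`, after adding a
small multiple of a homogeneous form which is positive in the direction `(0, 0, 1)`, the only
one in which `quadForm3` may degenerate. -/
lemma exists_quadForm3_add_mul_pos {M Ett Err Etr : ℝ × ℝ → ℝ} {a : ℝ} (b K : ℝ)
    (hM : SmoothOnCone1 M) (hEtt : SmoothOnCone1 Ett) (hErr : SmoothOnCone1 Err)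
    (hEtr : SmoothOnCone1 Etr) (hMe : IsEvenR M) (htro : IsOddR Etr)
    (hMa : HomogOrder a M) (htt : HomogOrder (a - 2) Ett) (hrr : HomogOrder (a - 2) Err)
    (htr : HomogOrder (a - 2) Etr) (hrr0 : 0 ≤ Err (1, 0))
    (h3 : ∀ q ∈ Cone1, q.2 ≠ 0 → (mat3 M Ett Err Etr q).PosDef)
    (h2 : ∀ q ∈ Cone1, q.2 = 0 → (mat2 M Ett q).PosDef) :
    ∃ ε > 0, ∀ q ∈ Cone1, ∀ x y z : ℝ, ¬(x = 0 ∧ y = 0 ∧ z = 0) →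
      0 < quadForm3 M Ett Err Etr q x y z
        + ε * (K * q.1 ^ a * x ^ 2 + K * a * q.1 ^ (a - 1) * x * y
          + b * q.1 ^ (a - 2) * y ^ 2 + q.1 ^ (a - 2) * z ^ 2) := by
  have hcone {r : ℝ} (hr : |r| ≤ 1) : ((1 : ℝ), r) ∈ Cone1 := ⟨one_pos, hr⟩
  set S : Set (ℝ × ℝ × ℝ × ℝ) :=
    {w | |w.1| ≤ 1 ∧ w.2.1 ^ 2 + w.2.2.1 ^ 2 + w.2.2.2 ^ 2 = 1}
  have hS : IsCompact S := by
    refine (isCompact_Icc (a := ((-1, -1, -1, -1) : ℝ × ℝ × ℝ × ℝ))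
      (b := (1, 1, 1, 1))).of_isClosed_subset ?_ ?_
    · have h1 : IsClosed {w : ℝ × ℝ × ℝ × ℝ | |w.1| ≤ 1} :=
        isClosed_le (by fun_prop) (by fun_prop)
      have h2 : IsClosed {w : ℝ × ℝ × ℝ × ℝ | w.2.1 ^ 2 + w.2.2.1 ^ 2 + w.2.2.2 ^ 2 = 1} :=
        isClosed_eq (by fun_prop) (by fun_prop)
      exact h1.inter h2
    · rintro ⟨r, x, y, z⟩ ⟨hr, hv⟩
      simp only at hr hv
      have hx : |x| ≤ 1 := by rw [← sq_le_one_iff_abs_le_one]; nlinarith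
      have hy : |y| ≤ 1 := by rw [← sq_le_one_iff_abs_le_one]; nlinarith
      have hz : |z| ≤ 1 := by rw [← sq_le_one_iff_abs_le_one]; nlinarith
      rw [abs_le] at hr hx hy hz
      exact ⟨⟨hr.1, hx.1, hy.1, hz.1⟩, ⟨hr.2, hx.2, hy.2, hz.2⟩⟩
  have hcont {f : ℝ × ℝ → ℝ} (hf : ∀ q ∈ Cone1, ContinuousAt f q) :
      ContinuousOn (fun w : ℝ × ℝ × ℝ × ℝ => f (1, w.1)) S := fun w hw =>
    ((hf _ (hcone hw.1)).comp (f := fun w : ℝ × ℝ × ℝ × ℝ => ((1 : ℝ), w.1))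
      (by fun_prop)).continuousWithinAt
  have hs {f : ℝ × ℝ → ℝ} (hf : SmoothOnCone1 f) : ∀ q ∈ Cone1, ContinuousAt f q :=
    fun q hq => (hf.contDiffAt hq 0).continuousAt
  have cM := hcont (hs hM)
  have cMt := hcont fun q hq =>
    (contDiffAt_pdt (n := 0) (by exact_mod_cast hM.contDiffAt hq 1)).continuousAt
  have cMr := hcont fun q hq =>
    (contDiffAt_pdr (n := 0) (by exact_mod_cast hM.contDiffAt hq 1)).continuousAt
  have ctt := hcont (hs hEtt)
  have crr := hcont (hs hErr)
  have ctr := hcont (hs hEtr)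
  have px : ContinuousOn (fun w : ℝ × ℝ × ℝ × ℝ => w.2.1) S := by fun_prop
  have py : ContinuousOn (fun w : ℝ × ℝ × ℝ × ℝ => w.2.2.1) S := by fun_prop
  have pz : ContinuousOn (fun w : ℝ × ℝ × ℝ × ℝ => w.2.2.2) S := by fun_prop
  have hMr0 : pdr M (1, 0) = 0 := hMe.pdr_eq_zero hM one_pos
  have htr0 : Etr (1, 0) = 0 := by
    have := htro (1, 0) (hcone (by simp))
    simp only [neg_zero] at this
    linarith
  have hq0 (x y z : ℝ) : quadForm3 M Ett Err Etr (1, 0) x y z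
      = (M (1, 0) * x ^ 2 + pdt M (1, 0) * x * y + Ett (1, 0) * y ^ 2) + Err (1, 0) * z ^ 2 := by
    simp only [quadForm3, hMr0, htr0]
    ring
  have hp2 := posDef_mat2_iff.1 (h2 (1, 0) (hcone (by simp)) rfl)
  have hpos {r x y z : ℝ} (hr : |r| ≤ 1) (hr0 : r ≠ 0) (hv : x ^ 2 + y ^ 2 + z ^ 2 = 1) :
      0 < quadForm3 M Ett Err Etr (1, r) x y z := by
    refine posDef_mat3_iff.1 (h3 (1, r) (hcone hr) hr0) x y z ?_
    rintro ⟨rfl, rfl, rfl⟩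
    norm_num at hv
  have hpos0 (x y z : ℝ) (hxy : ¬(x = 0 ∧ y = 0)) :
      0 < quadForm3 M Ett Err Etr (1, 0) x y z := by
    rw [hq0]
    exact add_pos_of_pos_of_nonneg (hp2 x y hxy) (mul_nonneg hrr0 (sq_nonneg z))
  obtain ⟨ε, hε, H⟩ := hS.exists_pos_forall_add_mul_pos
    (f := fun w => quadForm3 M Ett Err Etr (1, w.1) w.2.1 w.2.2.1 w.2.2.2)
    (g := fun w => K * w.2.1 ^ 2 + K * a * w.2.1 * w.2.2.1 + b * w.2.2.1 ^ 2 + w.2.2.2 ^ 2)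
    ((((((cM.mul (px.pow 2)).add ((cMt.mul px).mul py)).add ((cMr.mul px).mul pz)).add
      (ctt.mul (py.pow 2))).add (((continuousOn_const.mul ctr).mul py).mul pz)).add
      (crr.mul (pz.pow 2))) (by fun_prop)
    (by
      rintro ⟨r, x, y, z⟩ ⟨hr, hv⟩
      rcases eq_or_ne r 0 with rfl | hr0
      · by_cases hxy : x = 0 ∧ y = 0
        · obtain ⟨rfl, rfl⟩ := hxy
          simp only [hq0]
          nlinarith [mul_nonneg hrr0 (sq_nonneg z)]
        · exact (hpos0 x y z hxy).le
      · exact (hpos hr hr0 hv).le)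
    (by
      rintro ⟨r, x, y, z⟩ ⟨hr, hv⟩ hg
      rcases eq_or_ne r 0 with rfl | hr0
      · refine hpos0 x y z ?_
        rintro ⟨rfl, rfl⟩
        simp only at hv hg
        nlinarith
      · exact hpos hr hr0 hv)
  refine ⟨ε, hε, ?_⟩
  rintro ⟨t, r⟩ hq x y z hne
  have ht : 0 < t := hq.1
  have hr : |r / t| ≤ 1 := by
    rw [abs_div, abs_of_pos ht, div_le_one ht]
    exact hq.2
  have hn0 : 0 < x ^ 2 + (y / t) ^ 2 + (z / t) ^ 2 := by
    by_contra hcon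
    have hx : x ^ 2 = 0 := by nlinarith [sq_nonneg x, sq_nonneg (y / t), sq_nonneg (z / t)]
    have hy : (y / t) ^ 2 = 0 := by nlinarith [sq_nonneg x, sq_nonneg (y / t), sq_nonneg (z / t)]
    have hz : (z / t) ^ 2 = 0 := by nlinarith [sq_nonneg x, sq_nonneg (y / t), sq_nonneg (z / t)]
    simp only [pow_eq_zero_iff two_ne_zero, div_eq_zero_iff, ht.ne', or_false] at hx hy hz
    exact hne ⟨hx, hy, hz⟩
  obtain ⟨n, hnpos, hnsq⟩ : ∃ n : ℝ, 0 < n ∧ n ^ 2 = x ^ 2 + (y / t) ^ 2 + (z / t) ^ 2 :=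
    ⟨_, Real.sqrt_pos.2 hn0, Real.sq_sqrt hn0.le⟩
  obtain ⟨x', rfl⟩ : ∃ x', x = n * x' := ⟨x / n, by field_simp⟩
  obtain ⟨y', rfl⟩ : ∃ y', y = t * (n * y') := ⟨y / t / n, by field_simp⟩
  obtain ⟨z', rfl⟩ : ∃ z', z = t * (n * z') := ⟨z / t / n, by field_simp⟩
  have hunit : x' ^ 2 + y' ^ 2 + z' ^ 2 = 1 := by
    rw [mul_div_cancel_left₀ _ ht.ne', mul_div_cancel_left₀ _ ht.ne'] at hnsq
    have : n ^ 2 * (x' ^ 2 + y' ^ 2 + z' ^ 2) = n ^ 2 * 1 := by linear_combination -hnsq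
    exact mul_left_cancel₀ (by positivity) this
  have hmain := H (r / t, x', y', z') ⟨hr, hunit⟩
  have hsm := quadForm3_smul hM hMa htt hrr htr ht (hcone hr) (n * x') (n * y') (n * z')
  have htr' : t • ((1 : ℝ), r / t) = (t, r) := by
    ext
    · simp
    · simp [mul_div_cancel₀ _ ht.ne']
  have hn2 : quadForm3 M Ett Err Etr (1, r / t) (n * x') (n * y') (n * z')
      = n ^ 2 * quadForm3 M Ett Err Etr (1, r / t) x' y' z' := by
    unfold quadForm3
    ring
  have e1 : t ^ (a - 1) * t = t ^ a := by
    rw [Real.rpow_sub_one ht.ne', div_mul_cancel₀ _ ht.ne']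
  have e2 : t ^ (a - 2) * t ^ 2 = t ^ a := by
    rw [← Real.rpow_natCast, ← Real.rpow_add ht]
    congr 1
    push_cast
    ring
  rw [htr', hn2] at hsm
  rw [hsm]
  have hta : 0 < t ^ a := Real.rpow_pos_of_pos ht a
  refine lt_of_lt_of_eq (mul_pos (mul_pos hta (pow_pos hnpos 2)) hmain) ?_
  linear_combination -ε * n ^ 2 * (K * a * x' * y' * e1 + (b * y' ^ 2 + z' ^ 2) * e2)

/-- the relaxation step in Section 5: upgrading the non-strict
inequalities (5.8), (5.9) to the strict ones (5.4), (5.6).  Given fields satisfying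
all the structural conditions of Theorem 5.1 but with only the non-strict defocusing
inequality and non-strict positivity of `E_ωω`, there exist fields satisfying all the
structural conditions together with the strict inequalities. -/
theorem stmt19 (p : ℝ) (hp : 5 < p)
    (M Ett Err Eww Etr : ℝ × ℝ → ℝ)
    (hgood : GoodFields p M Ett Err Eww Etr)
    (hweakdef : ∀ q ∈ Cone1, q.2 ≠ 0 → 0 ≤ defocusQty M Ett Err Eww q)
    (hweakEww : ∀ q ∈ Cone1, 0 ≤ Eww q) :
    ∃ M' Ett' Err' Eww' Etr' : ℝ × ℝ → ℝ,
      GoodFields p M' Ett' Err' Eww' Etr' ∧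
      (∀ q ∈ Cone1, q.2 ≠ 0 → 0 < defocusQty M' Ett' Err' Eww' q) ∧
      (∀ q ∈ Cone1, 0 < Eww' q) := by
  obtain ⟨hM, htt, hrr, hww, htr, eM, ett, err, eww, otr, oM, ott, otr', orr, oww, hvan, heq1,
    heq2, h3, h2⟩ := hgood
  set a : ℝ := -(4 / (p - 1)) with ha
  have hp1 : 0 < p - 1 := by linarith
  have hb : -(2 * (p + 1) / (p - 1)) = a - 2 := by
    rw [ha]
    field_simp
    ring
  have hapos : 0 < a * (a - 1) := by
    have : a < 0 := by
      rw [ha]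
      exact neg_neg_of_pos (by positivity)
    nlinarith
  rw [hb] at ott otr' orr oww
  have hrr0 : 0 ≤ Err (1, 0) := by
    have h := hvan 1 one_pos 0 two_pos
    have h' := hweakEww (1, 0) ⟨one_pos, by simp⟩
    simp only [Function.iterate_zero, id_eq] at h
    linarith
  set K : ℝ := -(2 * (p + 9) / (a * (a - 1))) with hK
  have hKa : K * (a * (a - 1)) = -(2 * (p + 9)) := by
    rw [hK, neg_mul, div_mul_cancel₀ _ hapos.ne']
  obtain ⟨ε, hε, H⟩ := exists_quadForm3_add_mul_pos (-5) K hM htt hrr htr eM otr oM ott orr otr'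
    hrr0 h3 h2
  have hdM {q : ℝ × ℝ} (hq : q ∈ Cone1) : DifferentiableAt ℝ M q :=
    (hM.contDiffAt hq 1).differentiableAt (by simp)
  have hdtt {q : ℝ × ℝ} (hq : q ∈ Cone1) : DifferentiableAt ℝ Ett q :=
    (htt.contDiffAt hq 1).differentiableAt (by simp)
  have hdrr {q : ℝ × ℝ} (hq : q ∈ Cone1) : DifferentiableAt ℝ Err q :=
    (hrr.contDiffAt hq 1).differentiableAt (by simp)
  have hdww {q : ℝ × ℝ} (hq : q ∈ Cone1) : DifferentiableAt ℝ Eww q :=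
    (hww.contDiffAt hq 1).differentiableAt (by simp)
  have hquad : ∀ q ∈ Cone1, ∀ x y z : ℝ, ¬(x = 0 ∧ y = 0 ∧ z = 0) →
      0 < quadForm3 (fun z => M z + ε * K * z.1 ^ a) (fun z => Ett z + -5 * ε * z.1 ^ (a - 2))
        (fun z => Err z + ε * z.1 ^ (a - 2)) Etr q x y z := by
    intro q hq x y z hne
    refine lt_of_lt_of_eq (H q hq x y z hne) ?_
    simp only [quadForm3, pdt_add_mul_rpow (hdM hq) hq.1, pdr_add_mul_rpow (hdM hq) hq.1]
    ring
  have hdef {q : ℝ × ℝ} (hMq : ContDiffAt ℝ 2 M q) (hq : 0 < q.1) :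
      defocusQty (fun z => M z + ε * K * z.1 ^ a) (fun z => Ett z + -5 * ε * z.1 ^ (a - 2))
        (fun z => Err z + ε * z.1 ^ (a - 2)) (fun z => Eww z + ε * z.1 ^ (a - 2)) q
      = defocusQty M Ett Err Eww q + ε * (p + 1) * q.1 ^ (a - 2) := by
    rw [defocusQty_add_mul_rpow Ett Err Eww hMq hq]
    linear_combination (-ε / 2 * q.1 ^ (a - 2)) * hKa
  have hdefev {q : ℝ × ℝ} (hq : q ∈ Cone1) :
      defocusQty (fun z => M z + ε * K * z.1 ^ a) (fun z => Ett z + -5 * ε * z.1 ^ (a - 2))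
        (fun z => Err z + ε * z.1 ^ (a - 2)) (fun z => Eww z + ε * z.1 ^ (a - 2))
      =ᶠ[nhds q] fun z => defocusQty M Ett Err Eww z + ε * (p + 1) * z.1 ^ (a - 2) := by
    filter_upwards [(hM.contDiffAt hq 2).eventually (by simp), eventually_fst_pos hq.1]
      with z hz hz' using hdef hz hz'
  have hdd {q : ℝ × ℝ} (hq : q ∈ Cone1) (hq2 : q.2 ≠ 0) :
      DifferentiableAt ℝ (defocusQty M Ett Err Eww) q :=
    differentiableAt_defocusQty (hM.contDiffAt hq 3) (hdtt hq) (hdrr hq) (hdww hq) hq2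
  have htrace : (fun z : ℝ × ℝ => -(Ett z + -5 * ε * z.1 ^ (a - 2))
        + (Err z + ε * z.1 ^ (a - 2)) + 2 * (Eww z + ε * z.1 ^ (a - 2)))
      = fun z => (-(Ett z) + Err z + 2 * Eww z) + 8 * ε * z.1 ^ (a - 2) := by
    funext z
    ring
  have hdtrace {q : ℝ × ℝ} (hq : q ∈ Cone1) :
      DifferentiableAt ℝ (fun z => -(Ett z) + Err z + 2 * Eww z) q := by
    have := hdtt hq
    have := hdrr hq
    have := hdww hq
    fun_prop
  refine ⟨fun z => M z + ε * K * z.1 ^ a, fun z => Ett z + -5 * ε * z.1 ^ (a - 2),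
    fun z => Err z + ε * z.1 ^ (a - 2), fun z => Eww z + ε * z.1 ^ (a - 2), Etr, ?_, ?_, ?_⟩
  · refine ⟨hM.add_mul_rpow _ _, htt.add_mul_rpow _ _, hrr.add_mul_rpow _ _,
      hww.add_mul_rpow _ _, htr, eM.add_mul_rpow _ _, ett.add_mul_rpow _ _,
      err.add_mul_rpow _ _, eww.add_mul_rpow _ _, otr, oM.add_mul_rpow _, ?_, ?_, ?_, ?_,
      ?_, ?_, ?_, ?_, ?_⟩
    · rw [hb]
      exact ott.add_mul_rpow _
    · rwa [hb]
    · rw [hb]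
      exact orr.add_mul_rpow _
    · rw [hb]
      exact oww.add_mul_rpow _
    · simpa only [add_sub_add_right_eq_sub] using hvan
    · intro q hq hq2
      rw [pdt_congr (hdefev hq), pdt_add_mul_rpow (hdd hq hq2) hq.1, htrace,
        pdt_add_mul_rpow (hdtrace hq) hq.1, pdt_add_mul_rpow (hdtt hq) hq.1, heq1 q hq hq2]
      ring
    · intro q hq hq2
      rw [pdr_congr (hdefev hq), pdr_add_mul_rpow (hdd hq hq2) hq.1, htrace,
        pdr_add_mul_rpow (hdtrace hq) hq.1, pdr_add_mul_rpow (hdrr hq) hq.1, heq2 q hq hq2]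
      ring
    · exact fun q hq _ => posDef_mat3_iff.2 (hquad q hq)
    · refine fun q hq _ => posDef_mat2_iff.2 fun x y hxy => ?_
      have := hquad q hq x y 0 fun h => hxy ⟨h.1, h.2.1⟩
      refine lt_of_lt_of_eq this ?_
      simp only [quadForm3]
      ring
  · intro q hq hq2
    rw [hdef (hM.contDiffAt hq 2) hq.1]
    have := hweakdef q hq hq2
    have := Real.rpow_pos_of_pos hq.1 (a - 2)
    positivity
  · intro q hq
    have := hweakEww q hq
    have := Real.rpow_pos_of_pos hq.1 (a - 2)
    positivity
end
end
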